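/- Let N ≥ 3 be an integer, let a, b be reals with 0 < a < (N−2)/2 and a < b < a+1, set d := 1+a−b, 2♯ := 2N/(N−2d), δ_q := ((N−2a+2b)q − 2N)/(2q), q_c := (4+2N)/(N−2a+2b). Let q_c < q < 2♯, β > 0 and ρ > 0. Then for every radial u ∈ C_c^∞(ℝ^N), u ≠ 0, with ∫|x|^{−2a}|u|² dx = ρ² and P_β(u) := A(u) − βδ_q B_q(u) − B_{2♯}(u) = 0, one has: (a) βδ_q C_{a,b}^q ρ^{(1−δ_q)q}·A(u)^{(qδ_q−2)/2} + S(a,b)^{−2♯/2}·A(u)^{(2♯−2)/2} ≥ 1; (b) E_β(u) := (1/2)A(u) − (β/q)B_q(u) − (1/2♯)B_{2♯}(u) satisfies E_β(u) = β(δ_q/2 − 1/q)B_q(u) + (d/N)B_{2♯}(u) > 0. -/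

import Mathlib

open MeasureTheory Real Set Filter Asymptotics

noncomputable section

abbrev E (N : ℕ) := EuclideanSpace ℝ (Fin N)

/-- Weighted gradient integral `∫ |x|^{-2a} |∇u|²`. -/
def Aint (N : ℕ) (a : ℝ) (u : E N → ℝ) : ℝ :=
  ∫ x : E N, ‖x‖ ^ (-(2 * a)) * ‖fderiv ℝ u x‖ ^ 2

/-- Weighted mass `∫ |x|^{-2a} |u|²`. -/
def mint (N : ℕ) (a : ℝ) (u : E N → ℝ) : ℝ :=
  ∫ x : E N, ‖x‖ ^ (-(2 * a)) * (u x) ^ 2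

/-- Weighted `L^s` integral `∫ |x|^{-bs} |u|^s`. -/
def Bint (N : ℕ) (b s : ℝ) (u : E N → ℝ) : ℝ :=
  ∫ x : E N, ‖x‖ ^ (-(b * s)) * |u x| ^ s

/-- A function on `ℝ^N` is radial if it depends only on the norm. -/
def IsRadial {N : ℕ} (u : E N → ℝ) : Prop :=
  ∀ x y : E N, ‖x‖ = ‖y‖ → u x = u y

/-- The best Caffarelli–Kohn–Nirenberg constant `S(a,b)` (with critical exponent `p = 2♯`). -/
def Sab (N : ℕ) (a b p : ℝ) : ℝ :=
  sInf {r : ℝ | ∃ u : E N → ℝ, ContDiff ℝ (⊤ : ℕ∞) u ∧ HasCompactSupport u ∧ u ≠ 0 ∧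
    r = Aint N a u / (Bint N b p u) ^ (2 / p)}

theorem lintegral_le_of_ae_tendsto {α : Type*} [MeasurableSpace α] {μ : Measure α}
    {f : ℕ → α → ENNReal} {g : α → ENNReal} {C : ENNReal}
    (hf : ∀ n, AEMeasurable (f n) μ)
    (h : ∀ᵐ x ∂μ, Tendsto (fun n => f n x) atTop (nhds (g x)))
    (hC : ∀ n, ∫⁻ x, f n x ∂μ ≤ C) : ∫⁻ x, g x ∂μ ≤ C := by
  calc ∫⁻ x, g x ∂μ = ∫⁻ x, liminf (fun n => f n x) atTop ∂μ :=
        lintegral_congr_ae (h.mono fun x hx => hx.liminf_eq.symm)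
    _ ≤ liminf (fun n => ∫⁻ x, f n x ∂μ) atTop := lintegral_liminf_le' hf
    _ ≤ C := liminf_le_of_frequently_le' (Frequently.of_forall hC)

/-- The divergence theorem for the vector field `x ↦ g x • x`. -/
theorem integral_mul_add_fderiv_self_eq_zero {N : ℕ} {g : E N → ℝ} (hg : ContDiff ℝ 1 g)
    (hc : HasCompactSupport g) : ∫ x : E N, ((N : ℝ) * g x + fderiv ℝ g x x) = 0 := by
  have hdc : Continuous (fderiv ℝ g) := hg.continuous_fderiv one_ne_zero
  have hgi : Integrable g := hg.continuous.integrable_of_hasCompactSupport hc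
  have hdi : ∀ i : Fin N, Integrable fun x : E N =>
      x i * fderiv ℝ g x (EuclideanSpace.single i 1) := fun i => by
    refine Continuous.integrable_of_hasCompactSupport (by fun_prop) ?_
    exact (hc.fderiv_apply ℝ _).mul_left
  have key : ∀ i : Fin N,
      ∫ x : E N, x i * fderiv ℝ g x (EuclideanSpace.single i 1) = - ∫ x, g x := fun i => by
    have hd : ∀ x : E N, HasFDerivAt (fun x : E N => x i)
        (EuclideanSpace.proj i : E N →L[ℝ] ℝ) x :=
      fun x => (EuclideanSpace.proj i : E N →L[ℝ] ℝ).hasFDerivAt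
    have hd1 : ∀ x : E N,
        fderiv ℝ (fun x : E N => x i) x (EuclideanSpace.single i 1) = 1 := fun x => by
      rw [(hd x).fderiv]; simp
    have := integral_mul_fderiv_eq_neg_fderiv_mul_of_integrable (μ := volume)
      (f := fun x : E N => x i) (g := g) (v := EuclideanSpace.single i 1)
      (by simpa only [hd1, one_mul] using hgi) (hdi i)
      (Continuous.integrable_of_hasCompactSupport (by fun_prop) hc.mul_left)
      (fun x _ => (hd x).differentiableAt) (fun x _ => hg.differentiable one_ne_zero x)
    simpa only [hd1, one_mul] using this
  have hsum : ∀ x : E N, fderiv ℝ g x x =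
      ∑ i, x i * fderiv ℝ g x (EuclideanSpace.single i 1) := fun x => by
    have h := congrArg (fderiv ℝ g x) ((EuclideanSpace.basisFun (Fin N) ℝ).sum_repr x)
    rw [← h]
    simp [map_sum]
  simp_rw [hsum]
  rw [integral_add (hgi.const_mul _) (integrable_finsetSum _ fun i _ => hdi i),
    integral_finsetSum _ fun i _ => hdi i, integral_const_mul]
  simp [key]

theorem hasFDerivAt_norm_sq_add_rpow {N : ℕ} {ε : ℝ} (hε : 0 < ε) (r : ℝ) (x : E N) :
    HasFDerivAt (fun x : E N => (‖x‖ ^ 2 + ε) ^ r)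
      ((r * (‖x‖ ^ 2 + ε) ^ (r - 1)) • (2 • innerSL ℝ x)) x :=
  ((hasStrictFDerivAt_norm_sq x).hasFDerivAt.add_const ε).rpow_const
    (Or.inl (by positivity))

theorem contDiff_norm_sq_add_rpow {N : ℕ} {ε : ℝ} (hε : 0 < ε) (r : ℝ) {n : WithTop ℕ∞} :
    ContDiff ℝ n (fun x : E N => (‖x‖ ^ 2 + ε) ^ r) :=
  ((contDiff_norm_sq ℝ).add contDiff_const).rpow_const_of_ne
    fun x => by positivity

theorem weight_young {κ r x y v : ℝ} (hκ : 0 < κ) {w s : ℝ} (hw : x ^ 2 ≤ w) (hw0 : 0 < w)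
    (hr : |r| ≤ y * x) :
    κ * (w ^ (-s) * v ^ 2) - κ⁻¹ * (w ^ (-(s - 1)) * y ^ 2) ≤
      2 * κ * (w ^ (-s) * v ^ 2) + w ^ (-s) * (2 * v * r) := by
  have h1 : w ^ (-(s - 1)) = w ^ (-s) * w := by
    rw [← rpow_add_one hw0.ne']; congr 1; ring
  have hws : 0 < w ^ (-s) := rpow_pos_of_pos hw0 _
  have hr2 : r ^ 2 ≤ y ^ 2 * w := by
    calc r ^ 2 = |r| ^ 2 := (sq_abs r).symm
      _ ≤ (y * x) ^ 2 := by gcongr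
      _ = y ^ 2 * x ^ 2 := by ring
      _ ≤ y ^ 2 * w := by gcongr
  have h2 : 0 ≤ κ * v ^ 2 + κ⁻¹ * (y ^ 2 * w) + 2 * v * r := by
    have : κ * v ^ 2 + κ⁻¹ * r ^ 2 + 2 * v * r = κ⁻¹ * (κ * v + r) ^ 2 := by field_simp; ring
    have h3 : 0 ≤ κ⁻¹ * (κ * v + r) ^ 2 := by positivity
    have h4 : κ⁻¹ * r ^ 2 ≤ κ⁻¹ * (y ^ 2 * w) := by gcongr
    linarith
  rw [h1]
  nlinarith [mul_nonneg hws.le h2]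

/-- The weighted Hardy inequality with a regularized weight. -/
theorem hardy_regularized {N : ℕ} {s ε : ℝ} (hs : 0 ≤ s) (hsN : 2 * s < N) (hε : 0 < ε)
    {u : E N → ℝ} (hu : ContDiff ℝ 1 u) (hc : HasCompactSupport u) :
    ∫ x : E N, (‖x‖ ^ 2 + ε) ^ (-s) * u x ^ 2 ≤
      (2 / (N - 2 * s)) ^ 2 *
        ∫ x : E N, (‖x‖ ^ 2 + ε) ^ (-(s - 1)) * ‖fderiv ℝ u x‖ ^ 2 := by
  set κ : ℝ := (N - 2 * s) / 2 with hκ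
  have hκ0 : 0 < κ := by rw [hκ]; linarith
  have hw0 : ∀ x : E N, 0 < ‖x‖ ^ 2 + ε := fun x => by positivity
  set g : E N → ℝ := fun x => (‖x‖ ^ 2 + ε) ^ (-s) * u x ^ 2 with hgdef
  have hwc : ∀ r : ℝ, Continuous fun x : E N => (‖x‖ ^ 2 + ε) ^ r := fun r =>
    (contDiff_norm_sq_add_rpow hε r (n := 0)).continuous
  have hg : ContDiff ℝ 1 g := (contDiff_norm_sq_add_rpow hε _).mul (hu.pow 2)
  have hgc : HasCompactSupport g := by
    refine hc.mono' (subset_trans ?_ (subset_tsupport u))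
    intro x hx hux
    exact hx (by simp [hgdef, hux])
  have hdu : Continuous (fderiv ℝ u) := hu.continuous_fderiv one_ne_zero
  have hfd : ∀ x, fderiv ℝ g x x = (‖x‖ ^ 2 + ε) ^ (-s) * (2 * u x * fderiv ℝ u x x) +
      u x ^ 2 * (-s * (‖x‖ ^ 2 + ε) ^ (-s - 1) * (2 * ‖x‖ ^ 2)) := fun x => by
    have h1 := (hasFDerivAt_norm_sq_add_rpow hε (-s) x).mul
      ((hu.differentiable one_ne_zero x).hasFDerivAt.pow 2)
    rw [HasFDerivAt.fderiv (f := g) h1]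
    simp
  have hD : Integrable fun x : E N =>
      (‖x‖ ^ 2 + ε) ^ (-(s - 1)) * ‖fderiv ℝ u x‖ ^ 2 := by
    refine Continuous.integrable_of_hasCompactSupport ((hwc _).mul (by fun_prop)) ?_
    refine (hc.fderiv ℝ).mono' (subset_trans ?_ (subset_tsupport _))
    intro x hx hux
    exact hx (by simp [hux])
  have hgi : Integrable g := hg.continuous.integrable_of_hasCompactSupport hgc
  have hfi : Integrable fun x => fderiv ℝ g x x := by
    have hdg := hg.continuous_fderiv one_ne_zero
    refine Continuous.integrable_of_hasCompactSupport (by fun_prop) ?_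
    refine (hgc.fderiv ℝ).mono' (subset_trans ?_ (subset_tsupport _))
    intro x hx hux
    exact hx (by simp [hux])
  have hle : ∫ x, (κ * g x - κ⁻¹ * ((‖x‖ ^ 2 + ε) ^ (-(s - 1)) * ‖fderiv ℝ u x‖ ^ 2)) ≤
      ∫ x : E N, ((N : ℝ) * g x + fderiv ℝ g x x) := by
    refine integral_mono ((hgi.const_mul _).sub (hD.const_mul _))
      ((hgi.const_mul _).add hfi) fun x => ?_
    have hr : |fderiv ℝ u x x| ≤ ‖fderiv ℝ u x‖ * ‖x‖ := (fderiv ℝ u x).le_opNorm x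
    have h := weight_young (v := u x) (s := s) hκ0
      (le_add_of_nonneg_right hε.le : ‖x‖ ^ 2 ≤ ‖x‖ ^ 2 + ε) (hw0 x) hr
    have h1 : (‖x‖ ^ 2 + ε) ^ (-s - 1) * ‖x‖ ^ 2 ≤ (‖x‖ ^ 2 + ε) ^ (-s) := by
      calc _ ≤ (‖x‖ ^ 2 + ε) ^ (-s - 1) * (‖x‖ ^ 2 + ε) := by gcongr; linarith
        _ = _ := by rw [← rpow_add_one (hw0 x).ne']; congr 1; ring
    have h2 : s * u x ^ 2 * ((‖x‖ ^ 2 + ε) ^ (-s - 1) * ‖x‖ ^ 2) ≤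
        s * u x ^ 2 * (‖x‖ ^ 2 + ε) ^ (-s) := by gcongr
    simp only [hfd]
    refine h.trans ?_
    simp only [hgdef, hκ]
    nlinarith
  rw [integral_mul_add_fderiv_self_eq_zero hg hgc,
    integral_sub (hgi.const_mul _) (hD.const_mul _), integral_const_mul, integral_const_mul] at hle
  have h2 : (2 / (N - 2 * s)) = κ⁻¹ := by rw [hκ, inv_div]
  rw [h2]
  have h3 : κ⁻¹ * (κ * ∫ x, g x) ≤ κ⁻¹ * (κ⁻¹ *
      ∫ x : E N, (‖x‖ ^ 2 + ε) ^ (-(s - 1)) * ‖fderiv ℝ u x‖ ^ 2) :=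
    mul_le_mul_of_nonneg_left (by linarith) (by positivity)
  rw [inv_mul_cancel_left₀ hκ0.ne'] at h3
  calc _ ≤ _ := h3
    _ = _ := by ring

theorem hasCompactSupport_norm_fderiv_sq {N : ℕ} {u : E N → ℝ} (hc : HasCompactSupport u) :
    HasCompactSupport fun x => ‖fderiv ℝ u x‖ ^ 2 := by
  refine (hc.fderiv ℝ).mono' (subset_trans ?_ (subset_tsupport _))
  intro x hx hux
  exact hx (by simp [hux])

theorem norm_sq_add_rpow_le {N : ℕ} {a ε : ℝ} (ha : 0 ≤ a) (hε : 0 < ε) {x : E N} (hx : x ≠ 0) :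
    (‖x‖ ^ 2 + ε) ^ (-a) ≤ ‖x‖ ^ (-(2 * a)) := by
  have h0 : 0 < ‖x‖ := norm_pos_iff.mpr hx
  have h1 : ‖x‖ ^ (-(2 * a)) = (‖x‖ ^ 2) ^ (-a) := by
    rw [← rpow_natCast ‖x‖ 2, ← rpow_mul h0.le]; congr 1; push_cast; ring
  rw [h1]
  exact rpow_le_rpow_of_nonpos (by positivity) (by linarith) (by linarith)

theorem ae_ne_zero {N : ℕ} (hN : 3 ≤ N) : ∀ᵐ x : E N, x ≠ 0 := by
  have : Nonempty (Fin N) := ⟨⟨0, by omega⟩⟩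
  exact Measure.ae_ne volume 0

theorem integrable_norm_rpow_mul {N : ℕ} (hN : 3 ≤ N) {s : ℝ} (hsN : s < N)
    {h : E N → ℝ} (hh : Continuous h) (hc : HasCompactSupport h) :
    Integrable fun x : E N => ‖x‖ ^ (-s) * h x := by
  have hloc : LocallyIntegrable (fun x : E N => ‖x‖ ^ (-s)) :=
    locallyIntegrable_of_norm_le_rpow (C := 1) (α := s)
      (by rw [finrank_euclideanSpace_fin]; omega) (by rw [finrank_euclideanSpace_fin]; exact hsN)
      (Eventually.of_forall fun x => by
        rw [one_mul, Real.norm_of_nonneg (by positivity)])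
      (measurable_norm.pow_const _).aestronglyMeasurable
  simpa [smul_eq_mul, mul_comm] using hloc.integrable_smul_left_of_hasCompactSupport hh hc

theorem integrable_Aint {N : ℕ} (hN : 3 ≤ N) {a : ℝ} (haN : 2 * a < N) {u : E N → ℝ}
    (hu : ContDiff ℝ 1 u) (hc : HasCompactSupport u) :
    Integrable fun x : E N => ‖x‖ ^ (-(2 * a)) * ‖fderiv ℝ u x‖ ^ 2 := by
  have hdu : Continuous (fderiv ℝ u) := hu.continuous_fderiv one_ne_zero
  refine integrable_norm_rpow_mul hN haN (by fun_prop)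
    (hasCompactSupport_norm_fderiv_sq hc)

theorem integrable_regularized_mul {N : ℕ} {ε : ℝ} (hε : 0 < ε) (r : ℝ)
    {h : E N → ℝ} (hh : Continuous h) (hc : HasCompactSupport h) :
    Integrable fun x : E N => (‖x‖ ^ 2 + ε) ^ r * h x :=
  Continuous.integrable_of_hasCompactSupport
    ((contDiff_norm_sq_add_rpow hε r (n := 0)).continuous.mul hh) hc.mul_left

theorem Aint_nonneg {N : ℕ} (a : ℝ) (u : E N → ℝ) : 0 ≤ Aint N a u :=
  integral_nonneg fun _ => by positivity

theorem Bint_nonneg {N : ℕ} (b s : ℝ) (u : E N → ℝ) : 0 ≤ Bint N b s u :=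
  integral_nonneg fun _ => by positivity

theorem hasCompactSupport_sq {N : ℕ} {u : E N → ℝ} (hc : HasCompactSupport u) :
    HasCompactSupport fun x => u x ^ 2 := by
  refine hc.mono' (subset_trans ?_ (subset_tsupport _))
  intro x hx hux
  exact hx (by simp [hux])

theorem integral_regularized_le_Aint {N : ℕ} (hN : 3 ≤ N) {a ε : ℝ} (ha : 0 ≤ a) (haN : 2 * a < N)
    (hε : 0 < ε) {u : E N → ℝ} (hu : ContDiff ℝ 1 u) (hc : HasCompactSupport u) :
    ∫ x : E N, (‖x‖ ^ 2 + ε) ^ (-a) * ‖fderiv ℝ u x‖ ^ 2 ≤ Aint N a u := by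
  have hdu : Continuous (fderiv ℝ u) := hu.continuous_fderiv one_ne_zero
  refine integral_mono_ae (integrable_regularized_mul hε _ (by fun_prop)
    (hasCompactSupport_norm_fderiv_sq hc)) (integrable_Aint hN haN hu hc) ?_
  filter_upwards [ae_ne_zero hN] with x hx
  exact mul_le_mul_of_nonneg_right (norm_sq_add_rpow_le ha hε hx) (by positivity)

theorem hardy_regularized_le_Aint {N : ℕ} (hN : 3 ≤ N) {a ε : ℝ} (ha : 0 ≤ a)
    (haN : 2 * (a + 1) < N) (hε : 0 < ε) {u : E N → ℝ} (hu : ContDiff ℝ 1 u)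
    (hc : HasCompactSupport u) :
    ∫ x : E N, (‖x‖ ^ 2 + ε) ^ (-(a + 1)) * u x ^ 2 ≤
      (2 / (N - 2 * (a + 1))) ^ 2 * Aint N a u := by
  refine (hardy_regularized (by linarith) haN hε hu hc).trans ?_
  rw [add_sub_cancel_right]
  exact mul_le_mul_of_nonneg_left
    (integral_regularized_le_Aint hN ha (by linarith) hε hu hc) (by positivity)

theorem tendsto_norm_sq_add_rpow {N : ℕ} {x : E N} (hx : x ≠ 0) (r : ℝ) :
    Tendsto (fun n : ℕ => (‖x‖ ^ 2 + 1 / ((n : ℝ) + 1)) ^ r) atTop (nhds (‖x‖ ^ (2 * r))) := by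
  have h0 : 0 < ‖x‖ := norm_pos_iff.mpr hx
  have h := (tendsto_one_div_add_atTop_nhds_zero_nat (𝕜 := ℝ)).const_add (‖x‖ ^ 2)
  rw [add_zero] at h
  convert h.rpow_const (p := r) (Or.inl (by positivity)) using 2
  rw [← rpow_natCast ‖x‖ 2, ← rpow_mul h0.le]; norm_num

/-- The weighted Hardy inequality. -/
theorem lintegral_hardy {N : ℕ} (hN : 3 ≤ N) {a : ℝ} (ha : 0 ≤ a) (haN : 2 * (a + 1) < N)
    {u : E N → ℝ} (hu : ContDiff ℝ 1 u) (hc : HasCompactSupport u) :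
    ∫⁻ x : E N, ENNReal.ofReal (‖x‖ ^ (-(2 * (a + 1))) * u x ^ 2) ≤
      ENNReal.ofReal ((2 / (N - 2 * (a + 1))) ^ 2 * Aint N a u) := by
  have hint : ∀ n : ℕ, Integrable fun x : E N =>
      (‖x‖ ^ 2 + 1 / ((n : ℝ) + 1)) ^ (-(a + 1)) * u x ^ 2 := fun n => by
    refine integrable_regularized_mul (by positivity) _ (by fun_prop)
      (hasCompactSupport_sq hc)
  refine lintegral_le_of_ae_tendsto (f := fun (n : ℕ) x =>
    ENNReal.ofReal ((‖x‖ ^ 2 + 1 / ((n : ℝ) + 1)) ^ (-(a + 1)) * u x ^ 2))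
    (fun n => (hint n).aemeasurable.ennreal_ofReal) ?_ fun n => ?_
  · filter_upwards [ae_ne_zero hN] with x hx
    refine ENNReal.tendsto_ofReal ?_
    have h := (tendsto_norm_sq_add_rpow hx (-(a + 1))).mul_const (u x ^ 2)
    rwa [mul_neg] at h
  · rw [← ofReal_integral_eq_lintegral_ofReal (hint n)
      (Eventually.of_forall fun x => by positivity)]
    exact ENNReal.ofReal_le_ofReal
      (hardy_regularized_le_Aint hN ha haN (by positivity) hu hc)

/-- The Sobolev inequality for the exponent `2`. -/
theorem exists_lintegral_sobolev {N : ℕ} (hN : 3 ≤ N) {r : ℝ} (hr : r = 2 * N / ((N : ℝ) - 2)) :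
    ∃ K : ℝ, 0 < K ∧ ∀ v : E N → ℝ, ContDiff ℝ 1 v → HasCompactSupport v →
      ∫⁻ x, ENNReal.ofReal (|v x| ^ r) ≤
        ENNReal.ofReal (K * (∫ x, ‖fderiv ℝ v x‖ ^ 2) ^ (r / 2)) := by
  have hN3 : (3 : ℝ) ≤ N := by exact_mod_cast hN
  have hr0 : 0 < r := by rw [hr]; exact div_pos (by linarith) (by linarith)
  set c : NNReal := SNormLESNormFDerivOfEqConst (E := E N) ℝ volume 2 with hcdef
  refine ⟨(c + 1 : ℝ) ^ r, by positivity, fun v hv hc => ?_⟩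
  have hdv : Continuous (fderiv ℝ v) := hv.continuous_fderiv one_ne_zero
  have h := eLpNorm_le_eLpNorm_fderiv_of_eq (μ := (volume : Measure (E N))) hv hc
    (p := 2) (p' := r.toNNReal) one_le_two (by rw [finrank_euclideanSpace_fin]; omega)
    (by
      rw [finrank_euclideanSpace_fin, Real.coe_toNNReal _ hr0.le, hr]
      have : (N : ℝ) - 2 ≠ 0 := by linarith
      push_cast
      field_simp)
  have hI : ∫⁻ x, ‖fderiv ℝ v x‖ₑ ^ (2 : ℝ) = ENNReal.ofReal (∫ x, ‖fderiv ℝ v x‖ ^ 2) := by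
    rw [ofReal_integral_eq_lintegral_ofReal (Continuous.integrable_of_hasCompactSupport
      (by fun_prop) (hasCompactSupport_norm_fderiv_sq hc))
      (Eventually.of_forall fun x => by positivity)]
    refine lintegral_congr fun x => ?_
    rw [← ofReal_norm, ENNReal.ofReal_rpow_of_nonneg (norm_nonneg _) (by norm_num)]
    norm_num
  have hV : ∀ x, ENNReal.ofReal (|v x| ^ r) = ‖v x‖ₑ ^ r := fun x => by
    rw [← ofReal_norm, ENNReal.ofReal_rpow_of_nonneg (norm_nonneg _) hr0.le,
      Real.norm_eq_abs]
  rw [eLpNorm_nnreal_eq_lintegral (by simpa using hr0),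
    eLpNorm_nnreal_eq_lintegral (by norm_num), Real.coe_toNNReal _ hr0.le] at h
  have h2 := ENNReal.rpow_le_rpow h hr0.le
  rw [← ENNReal.rpow_mul, one_div_mul_cancel hr0.ne', ENNReal.rpow_one] at h2
  simp_rw [hV]
  refine h2.trans ?_
  set J := ∫ x, ‖fderiv ℝ v x‖ ^ 2 with hJ
  have hJ0 : 0 ≤ J := integral_nonneg fun x => by positivity
  simp only [NNReal.coe_ofNat]
  rw [hI, ENNReal.mul_rpow_of_nonneg _ _ hr0.le, ← ENNReal.rpow_mul,
    ENNReal.ofReal_rpow_of_nonneg hJ0 (by positivity), ENNReal.ofReal_mul (by positivity),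
    ← ENNReal.ofReal_rpow_of_nonneg (by positivity) hr0.le,
    show 1 / 2 * r = r / 2 by ring]
  gcongr
  rw [← ENNReal.ofReal_coe_nnreal]
  exact ENNReal.ofReal_le_ofReal (by simp [hcdef])

theorem norm_fderiv_regularized_mul_sq_le {N : ℕ} {a ε : ℝ} (ha : 0 ≤ a) (hε : 0 < ε)
    {u : E N → ℝ} (hu : ContDiff ℝ 1 u) (x : E N) :
    ‖fderiv ℝ (fun x : E N => (‖x‖ ^ 2 + ε) ^ (-a / 2) * u x) x‖ ^ 2 ≤
      2 * ((‖x‖ ^ 2 + ε) ^ (-a) * ‖fderiv ℝ u x‖ ^ 2) +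
        2 * a ^ 2 * ((‖x‖ ^ 2 + ε) ^ (-(a + 1)) * u x ^ 2) := by
  have hw : 0 < ‖x‖ ^ 2 + ε := by positivity
  have h1 := (hasFDerivAt_norm_sq_add_rpow hε (-a / 2) x).mul
      (hu.differentiable one_ne_zero x).hasFDerivAt
  rw [HasFDerivAt.fderiv (f := fun x : E N => (‖x‖ ^ 2 + ε) ^ (-a / 2) * u x) h1]
  set w := ‖x‖ ^ 2 + ε with hwdef
  have hA : (w ^ (-a / 2)) ^ 2 = w ^ (-a) := by
    rw [← rpow_natCast, ← rpow_mul hw.le]; congr 1; push_cast; ring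
  have hB : (w ^ (-a / 2 - 1)) ^ 2 * w = w ^ (-(a + 1)) := by
    rw [← rpow_natCast, ← rpow_mul hw.le, ← rpow_add_one hw.ne']; congr 1; push_cast; ring
  have hn : ‖w ^ (-a / 2) • fderiv ℝ u x +
      u x • ((-a / 2 * w ^ (-a / 2 - 1)) • (2 • innerSL ℝ x))‖ ≤
      w ^ (-a / 2) * ‖fderiv ℝ u x‖ + |u x| * (a * w ^ (-a / 2 - 1) * ‖x‖) := by
    refine (norm_add_le _ _).trans (add_le_add ?_ ?_)
    · rw [norm_smul, Real.norm_of_nonneg (by positivity)]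
    · rw [norm_smul, norm_smul, Real.norm_eq_abs, Real.norm_eq_abs, abs_mul, abs_div, abs_neg,
        abs_of_nonneg ha, abs_of_pos (rpow_pos_of_pos hw _), ← Nat.cast_smul_eq_nsmul ℝ,
        norm_smul, innerSL_apply_norm]
      norm_num
      apply le_of_eq
      ring
  have hx : ‖x‖ ^ 2 ≤ w := by rw [hwdef]; linarith
  calc _ ≤ (w ^ (-a / 2) * ‖fderiv ℝ u x‖ + |u x| * (a * w ^ (-a / 2 - 1) * ‖x‖)) ^ 2 := by
        gcongr
    _ ≤ 2 * (w ^ (-a / 2) * ‖fderiv ℝ u x‖) ^ 2 +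
        2 * (|u x| * (a * w ^ (-a / 2 - 1) * ‖x‖)) ^ 2 := by
        nlinarith [sq_nonneg (w ^ (-a / 2) * ‖fderiv ℝ u x‖ -
          |u x| * (a * w ^ (-a / 2 - 1) * ‖x‖))]
    _ = 2 * ((w ^ (-a / 2)) ^ 2 * ‖fderiv ℝ u x‖ ^ 2) +
        2 * a ^ 2 * ((w ^ (-a / 2 - 1)) ^ 2 * ‖x‖ ^ 2 * u x ^ 2) := by
        rw [mul_pow, mul_pow |u x|, sq_abs]; ring
    _ ≤ 2 * ((w ^ (-a / 2)) ^ 2 * ‖fderiv ℝ u x‖ ^ 2) +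
        2 * a ^ 2 * ((w ^ (-a / 2 - 1)) ^ 2 * w * u x ^ 2) := by gcongr
    _ = _ := by rw [hA, hB]

/-- The weighted Sobolev inequality. -/
theorem exists_lintegral_weighted_sobolev {N : ℕ} (hN : 3 ≤ N) {a r : ℝ} (ha : 0 ≤ a)
    (haN : 2 * (a + 1) < N) (hr : r = 2 * N / ((N : ℝ) - 2)) :
    ∃ K : ℝ, 0 < K ∧ ∀ u : E N → ℝ, ContDiff ℝ 1 u → HasCompactSupport u →
      ∫⁻ x : E N, ENNReal.ofReal (‖x‖ ^ (-(a * r)) * |u x| ^ r) ≤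
        ENNReal.ofReal (K * Aint N a u ^ (r / 2)) := by
  have hN3 : (3 : ℝ) ≤ N := by exact_mod_cast hN
  have hr0 : 0 < r := by rw [hr]; exact div_pos (by linarith) (by linarith)
  obtain ⟨K, hK, hsob⟩ := exists_lintegral_sobolev hN hr
  set c : ℝ := 2 + 2 * a ^ 2 * (2 / (N - 2 * (a + 1))) ^ 2 with hcdef
  have hc0 : 0 < c := by positivity
  refine ⟨K * c ^ (r / 2), by positivity, fun u hu hc => ?_⟩
  have hdu : Continuous (fderiv ℝ u) := hu.continuous_fderiv one_ne_zero
  set v : ℕ → E N → ℝ := fun n x => (‖x‖ ^ 2 + 1 / ((n : ℝ) + 1)) ^ (-a / 2) * u x with hvdef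
  have hv : ∀ n, ContDiff ℝ 1 (v n) := fun n =>
    (contDiff_norm_sq_add_rpow (by positivity) _).mul hu
  have hvc : ∀ n, HasCompactSupport (v n) := fun n => hc.mul_left
  refine lintegral_le_of_ae_tendsto (f := fun n x => ENNReal.ofReal (|v n x| ^ r))
    (fun n => ?_) ?_ fun n => ?_
  · have := (hv n).continuous.measurable
    exact Measurable.aemeasurable (by fun_prop)
  · filter_upwards [ae_ne_zero hN] with x hx
    refine ENNReal.tendsto_ofReal ?_
    have h := (((tendsto_norm_sq_add_rpow hx (-a / 2)).mul_const (u x)).abs).rpow_const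
      (p := r) (Or.inr hr0.le)
    convert h using 2
    rw [abs_mul, abs_of_nonneg (rpow_nonneg (norm_nonneg x) _), mul_rpow (by positivity) (abs_nonneg _),
      ← rpow_mul (norm_nonneg _)]
    congr 2
    ring
  · refine (hsob _ (hv n) (hvc n)).trans (ENNReal.ofReal_le_ofReal ?_)
    have hε : (0 : ℝ) < 1 / ((n : ℝ) + 1) := by positivity
    have hdv : Continuous (fderiv ℝ (v n)) := (hv n).continuous_fderiv one_ne_zero
    have hi1 := integrable_regularized_mul hε (-a) (h := fun x => ‖fderiv ℝ u x‖ ^ 2)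
      (by fun_prop) (hasCompactSupport_norm_fderiv_sq hc)
    have hi2 := integrable_regularized_mul hε (-(a + 1)) (h := fun x => u x ^ 2)
      (by fun_prop) (hasCompactSupport_sq hc)
    have hle : ∫ x, ‖fderiv ℝ (v n) x‖ ^ 2 ≤ c * Aint N a u := by
      calc ∫ x, ‖fderiv ℝ (v n) x‖ ^ 2 ≤ ∫ x : E N,
            (2 * ((‖x‖ ^ 2 + 1 / ((n : ℝ) + 1)) ^ (-a) * ‖fderiv ℝ u x‖ ^ 2) +
            2 * a ^ 2 * ((‖x‖ ^ 2 + 1 / ((n : ℝ) + 1)) ^ (-(a + 1)) * u x ^ 2)) :=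
            integral_mono (Continuous.integrable_of_hasCompactSupport (by fun_prop)
              (hasCompactSupport_norm_fderiv_sq (hvc n)))
              ((hi1.const_mul _).add (hi2.const_mul _))
              (norm_fderiv_regularized_mul_sq_le ha hε hu)
        _ ≤ 2 * Aint N a u +
            2 * a ^ 2 * ((2 / (N - 2 * (a + 1))) ^ 2 * Aint N a u) := by
            rw [integral_add (hi1.const_mul _) (hi2.const_mul _), integral_const_mul,
              integral_const_mul]
            exact add_le_add
              (mul_le_mul_of_nonneg_left
                (integral_regularized_le_Aint hN ha (by linarith) hε hu hc) (by positivity))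
              (mul_le_mul_of_nonneg_left
                (hardy_regularized_le_Aint hN ha haN hε hu hc) (by positivity))
        _ = c * Aint N a u := by rw [hcdef]; ring
    rw [mul_assoc, ← mul_rpow hc0.le (Aint_nonneg a u)]
    have h0 : 0 ≤ ∫ x, ‖fderiv ℝ (v n) x‖ ^ 2 := integral_nonneg fun x => by positivity
    gcongr

/-- The Caffarelli–Kohn–Nirenberg inequality, by interpolation between the weighted Hardy and
Sobolev inequalities. -/
theorem exists_ckn {N : ℕ} (hN : 3 ≤ N) {a b d p : ℝ} (ha : 0 ≤ a)
    (haN : 2 * (a + 1) < N) (hab : a < b) (hb : b < a + 1) (hd : d = 1 + a - b)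
    (hp : p = 2 * N / ((N : ℝ) - 2 * d)) :
    ∃ M : ℝ, 0 < M ∧ ∀ u : E N → ℝ, ContDiff ℝ 1 u → HasCompactSupport u →
      Integrable (fun x : E N => ‖x‖ ^ (-(b * p)) * |u x| ^ p) ∧
      Bint N b p u ≤ M * Aint N a u ^ (p / 2) := by
  have hN3 : (3 : ℝ) ≤ N := by exact_mod_cast hN
  have hNd : 0 < (N : ℝ) - 2 * d := by linarith
  have hN2 : 0 < (N : ℝ) - 2 := by linarith
  obtain ⟨K, hK, hsob⟩ := exists_lintegral_weighted_sobolev hN ha haN (r := _) rfl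
  set r : ℝ := 2 * N / ((N : ℝ) - 2) with hr
  set C : ℝ := (2 / (N - 2 * (a + 1))) ^ 2 with hC
  have hC0 : 0 < C := by
    have : (N : ℝ) - 2 * (a + 1) ≠ 0 := by linarith
    positivity
  set θ : ℝ := (1 - d) * N / (N - 2 * d) with hθ
  set η : ℝ := d * (N - 2) / (N - 2 * d) with hη
  have hd0 : 0 < d := by linarith
  have hd1 : 0 < 1 - d := by linarith
  have hθ0 : 0 < θ := by positivity
  have hη0 : 0 < η := by positivity
  have hsum : θ + η = 1 := by rw [hθ, hη, ← add_div, div_eq_one_iff_eq hNd.ne']; ring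
  have hp0 : 0 < p := by rw [hp]; positivity
  have hpe : p = 2 * θ + r * η := by rw [hp, hθ, hη, hr]; field_simp; ring
  have hbp : b * p = 2 * (a + 1) * θ + a * r * η := by
    have hb' : b = 1 + a - d := by linarith
    rw [hp, hθ, hη, hr, hb']; field_simp; ring
  refine ⟨C ^ θ * K ^ η, by positivity, fun u hu hc => ?_⟩
  have hum : Measurable u := hu.continuous.measurable
  have hA0 := Aint_nonneg a u
  have hmeas : Measurable fun x : E N => ‖x‖ ^ (-(b * p)) * |u x| ^ p := by fun_prop
  have hpt : ∀ᵐ x : E N, ENNReal.ofReal (‖x‖ ^ (-(b * p)) * |u x| ^ p) =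
      ENNReal.ofReal (‖x‖ ^ (-(2 * (a + 1))) * u x ^ 2) ^ θ *
        ENNReal.ofReal (‖x‖ ^ (-(a * r)) * |u x| ^ r) ^ η := by
    filter_upwards [ae_ne_zero hN] with x hx
    have h0 : 0 < ‖x‖ := norm_pos_iff.mpr hx
    rw [ENNReal.ofReal_rpow_of_nonneg (by positivity) hθ0.le,
      ENNReal.ofReal_rpow_of_nonneg (by positivity) hη0.le,
      ← ENNReal.ofReal_mul (by positivity)]
    congr 1
    rw [mul_rpow (by positivity) (by positivity), mul_rpow (by positivity) (by positivity),
      ← sq_abs, ← rpow_natCast |u x| 2, ← rpow_mul h0.le, ← rpow_mul h0.le,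
      ← rpow_mul (abs_nonneg _), ← rpow_mul (abs_nonneg _), hbp, hpe,
      rpow_add_of_nonneg (abs_nonneg _) (by positivity) (by positivity),
      show -(2 * (a + 1) * θ + a * r * η) = -(2 * (a + 1)) * θ + -(a * r) * η by ring,
      rpow_add h0]
    push_cast
    ring
  have hle : ∫⁻ x : E N, ENNReal.ofReal (‖x‖ ^ (-(b * p)) * |u x| ^ p) ≤
      ENNReal.ofReal (C ^ θ * K ^ η * Aint N a u ^ (p / 2)) := by
    rw [lintegral_congr_ae hpt]
    refine (ENNReal.lintegral_mul_norm_pow_le (by fun_prop) (by fun_prop)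
      hθ0.le hη0.le hsum).trans ?_
    have h1 := ENNReal.rpow_le_rpow (lintegral_hardy hN ha haN hu hc) hθ0.le
    have h2 := ENNReal.rpow_le_rpow (hsob u hu hc) hη0.le
    refine (mul_le_mul' h1 h2).trans (le_of_eq ?_)
    rw [ENNReal.ofReal_rpow_of_nonneg (by positivity) hθ0.le,
      ENNReal.ofReal_rpow_of_nonneg (by positivity) hη0.le,
      ← ENNReal.ofReal_mul (by positivity)]
    congr 1
    rw [mul_rpow hC0.le hA0, mul_rpow hK.le (by positivity), ← rpow_mul hA0,
      show p / 2 = θ + r / 2 * η by rw [hpe]; ring,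
      rpow_add_of_nonneg hA0 hθ0.le (by positivity)]
    ring
  have hnn : 0 ≤ᵐ[volume] fun x : E N => ‖x‖ ^ (-(b * p)) * |u x| ^ p :=
    Eventually.of_forall fun x => by positivity
  refine ⟨⟨hmeas.aestronglyMeasurable, ?_⟩, ?_⟩
  · rw [hasFiniteIntegral_iff_ofReal hnn]
    exact hle.trans_lt ENNReal.ofReal_lt_top
  · rw [Bint, integral_eq_lintegral_of_nonneg_ae hnn hmeas.aestronglyMeasurable]
    exact ENNReal.toReal_le_of_le_ofReal (by positivity) hle

theorem Bint_pos {N : ℕ} (hN : 3 ≤ N) {b s : ℝ} {u : E N → ℝ} (hu : Continuous u) (h0 : u ≠ 0)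
    (hi : Integrable fun x : E N => ‖x‖ ^ (-(b * s)) * |u x| ^ s) : 0 < Bint N b s u := by
  rw [Bint, integral_pos_iff_support_of_nonneg_ae (Eventually.of_forall fun x => by positivity) hi]
  have : Nonempty (Fin N) := ⟨⟨0, by omega⟩⟩
  have hopen : IsOpen (Function.support u) := hu.isOpen_support
  have hpos : 0 < volume (Function.support u) :=
    hopen.measure_pos volume (Function.support_nonempty_iff.mpr h0)
  rw [← measure_sdiff_null (measure_singleton (0 : E N))] at hpos
  refine hpos.trans_le (measure_mono fun x hx => ?_)
  have hx0 : 0 < ‖x‖ := norm_pos_iff.mpr hx.2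
  have hux : 0 < |u x| := abs_pos.mpr hx.1
  exact (mul_pos (rpow_pos_of_pos hx0 _) (rpow_pos_of_pos hux _)).ne'

/-- The best constant `S(a,b)` is positive, and it controls the critical integral. -/
theorem Bint_le_Sab_rpow_mul {N : ℕ} (hN : 3 ≤ N) {a b d p : ℝ} (ha : 0 ≤ a)
    (haN : 2 * (a + 1) < N) (hab : a < b) (hb : b < a + 1) (hd : d = 1 + a - b)
    (hp : p = 2 * N / ((N : ℝ) - 2 * d)) {u : E N → ℝ} (hu : ContDiff ℝ (⊤ : ℕ∞) u)
    (hc : HasCompactSupport u) (h0 : u ≠ 0) :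
    0 < Bint N b p u ∧ Bint N b p u ≤ Sab N a b p ^ (-(p / 2)) * Aint N a u ^ (p / 2) := by
  have hN3 : (3 : ℝ) ≤ N := by exact_mod_cast hN
  have hp0 : 0 < p := by rw [hp]; exact div_pos (by linarith) (by linarith)
  obtain ⟨M, hM, hckn⟩ := exists_ckn hN ha haN hab hb hd hp
  have hpos : ∀ w : E N → ℝ, ContDiff ℝ (⊤ : ℕ∞) w → HasCompactSupport w → w ≠ 0 →
      0 < Bint N b p w := fun w hw hwc hw0 =>
    Bint_pos hN hw.continuous hw0 (hckn w (hw.of_le (by exact_mod_cast le_top)) hwc).1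
  have hlow : ∀ w : E N → ℝ, ContDiff ℝ (⊤ : ℕ∞) w → HasCompactSupport w → w ≠ 0 →
      M ^ (-(2 / p)) ≤ Aint N a w / Bint N b p w ^ (2 / p) := fun w hw hwc hw0 => by
    have h1 := (hckn w (hw.of_le (by exact_mod_cast le_top)) hwc).2
    have hB := hpos w hw hwc hw0
    have hA := Aint_nonneg a w
    rw [le_div_iff₀ (rpow_pos_of_pos hB _)]
    calc M ^ (-(2 / p)) * Bint N b p w ^ (2 / p)
        ≤ M ^ (-(2 / p)) * (M * Aint N a w ^ (p / 2)) ^ (2 / p) := by gcongr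
      _ = Aint N a w := by
        rw [mul_rpow hM.le (by positivity), ← rpow_mul hA, ← mul_assoc, ← rpow_add hM,
          show p / 2 * (2 / p) = 1 by field_simp]
        simp
  have hS0 : 0 < Sab N a b p := by
    refine (rpow_pos_of_pos hM (-(2 / p))).trans_le ?_
    refine le_csInf ⟨_, u, hu, hc, h0, rfl⟩ ?_
    rintro r ⟨w, hw, hwc, hw0, rfl⟩
    exact hlow w hw hwc hw0
  have hSle : Sab N a b p ≤ Aint N a u / Bint N b p u ^ (2 / p) := by
    refine csInf_le ⟨M ^ (-(2 / p)), ?_⟩ ⟨u, hu, hc, h0, rfl⟩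
    rintro r ⟨w, hw, hwc, hw0, rfl⟩
    exact hlow w hw hwc hw0
  have hB := hpos u hu hc h0
  refine ⟨hB, ?_⟩
  rw [le_div_iff₀ (rpow_pos_of_pos hB _)] at hSle
  have h3 : (Sab N a b p * Bint N b p u ^ (2 / p)) ^ (p / 2) ≤ Aint N a u ^ (p / 2) :=
    rpow_le_rpow (by positivity) hSle (by positivity)
  rw [mul_rpow hS0.le (by positivity), ← rpow_mul hB.le,
    show 2 / p * (p / 2) = 1 by field_simp, rpow_one] at h3
  rw [rpow_neg hS0.le, inv_mul_eq_div, le_div_iff₀' (rpow_pos_of_pos hS0 _)]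
  exact h3

/-- Lemma 6.3 (mass-supercritical bounds on the Pohozaev manifold): for `q_c < q < 2♯`,
`β > 0`, `ρ > 0` and any nonzero radial test function `u` of mass `ρ²` with `P_β(u) = 0`:
(a) `βδ_qC^qρ^{(1-δ_q)q}A(u)^{(qδ_q-2)/2} + S(a,b)^{-2♯/2}A(u)^{(2♯-2)/2} ≥ 1` and
(b) `E_β(u) = β(δ_q/2 - 1/q)B_q(u) + (d/N)B_{2♯}(u) > 0`. -/
theorem supercritical_pohozaev_bounds (N : ℕ) (hN : 3 ≤ N) (a b d p q qc δ ρ β Cab : ℝ)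
    (ha : 0 < a) (ha' : a < ((N : ℝ) - 2) / 2) (hab : a < b) (hb : b < a + 1)
    (hd : d = 1 + a - b) (hp : p = 2 * N / ((N : ℝ) - 2 * d))
    (hδ : δ = (((N : ℝ) - 2 * a + 2 * b) * q - 2 * N) / (2 * q))
    (hqc : qc = (4 + 2 * N) / ((N : ℝ) - 2 * a + 2 * b))
    (hq : qc < q) (hq' : q < p) (hβ : 0 < β) (hρ : 0 < ρ)
    (hCab : IsLeast {C : ℝ | 0 < C ∧ ∀ u : E N → ℝ,
      ContDiff ℝ (⊤ : ℕ∞) u → HasCompactSupport u →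
        (Bint N b q u) ^ (1 / q) ≤
          C * (Aint N a u) ^ (δ / 2) * (mint N a u) ^ ((1 - δ) / 2)} Cab) :
    ∀ u : E N → ℝ, ContDiff ℝ (⊤ : ℕ∞) u → HasCompactSupport u → IsRadial u → u ≠ 0 →
      mint N a u = ρ ^ 2 →
      Aint N a u - β * δ * Bint N b q u - Bint N b p u = 0 →
      (β * δ * Cab ^ q * ρ ^ ((1 - δ) * q) * (Aint N a u) ^ ((q * δ - 2) / 2)
        + (Sab N a b p) ^ (-(p / 2)) * (Aint N a u) ^ ((p - 2) / 2) ≥ 1) ∧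
      ((1 / 2) * Aint N a u - (β / q) * Bint N b q u - (1 / p) * Bint N b p u
        = β * (δ / 2 - 1 / q) * Bint N b q u + (d / (N : ℝ)) * Bint N b p u) ∧
      0 < (1 / 2) * Aint N a u - (β / q) * Bint N b q u - (1 / p) * Bint N b p u := by
  intro u hu hc _ h0 hm hP
  have hN3 : (3 : ℝ) ≤ N := by exact_mod_cast hN
  have hNab : 0 < (N : ℝ) - 2 * a + 2 * b := by linarith
  have hNd : 0 < (N : ℝ) - 2 * d := by linarith
  have hq0 : 0 < q := lt_trans (by rw [hqc]; positivity) hq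
  have hp0 : 0 < p := hq0.trans hq'
  have hqδ : 2 < q * δ := by
    rw [hqc, div_lt_iff₀ hNab] at hq
    have : q * δ = (((N : ℝ) - 2 * a + 2 * b) * q - 2 * N) / 2 := by
      rw [hδ]; field_simp
    rw [this]
    linarith
  have hδ0 : 0 < δ := pos_of_mul_pos_right (by linarith : 0 < q * δ) hq0.le
  obtain ⟨hBp, hBpS⟩ := Bint_le_Sab_rpow_mul hN ha.le (by linarith) hab hb hd hp hu hc h0
  have hBq : 0 ≤ Bint N b q u := Bint_nonneg b q u
  have hA : 0 < Aint N a u := by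
    have : 0 ≤ β * δ * Bint N b q u := by positivity
    linarith
  have hδq : 0 < δ / 2 - 1 / q := by
    rw [sub_pos, div_lt_div_iff₀ hq0 two_pos]
    linarith
  have hE : (1 / 2) * Aint N a u - (β / q) * Bint N b q u - (1 / p) * Bint N b p u
      = β * (δ / 2 - 1 / q) * Bint N b q u + (d / (N : ℝ)) * Bint N b p u := by
    have h1 : 1 / p = 1 / 2 - d / N := by
      rw [hp]
      field_simp
    rw [h1, show Aint N a u = β * δ * Bint N b q u + Bint N b p u by linarith]
    ring
  refine ⟨?_, hE, ?_⟩
  · obtain ⟨hC0, hC⟩ := hCab.1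
    have hGN : Bint N b q u ≤ Cab ^ q * ρ ^ ((1 - δ) * q) * Aint N a u ^ (q * δ / 2) := by
      have h1 := rpow_le_rpow (by positivity) (hC u hu hc) hq0.le
      rw [← rpow_mul hBq, one_div_mul_cancel hq0.ne', rpow_one, hm, ← rpow_natCast ρ 2,
        ← rpow_mul hρ.le, mul_rpow (by positivity) (by positivity),
        mul_rpow hC0.le (by positivity), ← rpow_mul hA.le, ← rpow_mul hρ.le] at h1
      refine h1.trans (le_of_eq ?_)
      rw [show δ / 2 * q = q * δ / 2 by ring,
        show ((2 : ℕ) : ℝ) * ((1 - δ) / 2) * q = (1 - δ) * q by push_cast; ring]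
      ring
    have h2 : Aint N a u ^ (q * δ / 2) = Aint N a u ^ ((q * δ - 2) / 2) * Aint N a u := by
      rw [← rpow_add_one hA.ne']; congr 1; ring
    have h3 : Aint N a u ^ (p / 2) = Aint N a u ^ ((p - 2) / 2) * Aint N a u := by
      rw [← rpow_add_one hA.ne']; congr 1; ring
    rw [h2] at hGN
    rw [h3] at hBpS
    have h4 := mul_le_mul_of_nonneg_left hGN (by positivity : 0 ≤ β * δ)
    refine le_of_mul_le_mul_right ?_ hA
    linarith
  · rw [hE]
    have hd0 : 0 < d := by linarith
    have : 0 ≤ β * (δ / 2 - 1 / q) * Bint N b q u := by positivity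
    have : 0 < d / (N : ℝ) * Bint N b p u := by positivity
    linarith
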